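/- Let x be a solution of the opinion dynamics. Then x_t(α) ∈ [0,1] for all α ∈ [0,1] and all t ≥ 0, and moreover |x_t(α) − x_s(α)| ≤ W·|t − s| for all α ∈ [0,1] and all s, t ≥ 0. -/

import Mathlib

open MeasureTheory Filter Set Topology

/-- The interaction field at time `t` for agent `α`:
`∫_0^1 w(t,α,β,x_t(α),x_t(β)) · (x_t(β) − x_t(α)) dβ`. -/
noncomputable def interactionField (w : ℝ → ℝ → ℝ → ℝ → ℝ → ℝ) (x : ℝ → ℝ → ℝ)
    (t α : ℝ) : ℝ :=
  ∫ β in (0:ℝ)..1, w t α β (x t α) (x t β) * (x t β - x t α)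

/-- `f` is absolutely continuous on the compact interval `[a,b]`. -/
def AbsolutelyContinuousOn (f : ℝ → ℝ) (a b : ℝ) : Prop :=
  ∀ ε > 0, ∃ δ > 0, ∀ n : ℕ, ∀ c d : Fin n → ℝ,
    (∀ i, a ≤ c i ∧ c i ≤ d i ∧ d i ≤ b) →
    (Pairwise fun i j => Set.Ioo (c i) (d i) ∩ Set.Ioo (c j) (d j) = ∅) →
    (∑ i, (d i - c i)) < δ → (∑ i, |f (d i) - f (c i)|) < ε

/-- `w` is an admissible weight function: jointly Borel measurable, nonnegative and
bounded by `W` on the domain `[0,∞) × [0,1] × [0,1] × ℝ × ℝ`. -/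
structure IsWeight (W : ℝ) (w : ℝ → ℝ → ℝ → ℝ → ℝ → ℝ) : Prop where
  measurable : Measurable fun p : ℝ × ℝ × ℝ × ℝ × ℝ =>
    w p.1 p.2.1 p.2.2.1 p.2.2.2.1 p.2.2.2.2
  nonneg : ∀ t, 0 ≤ t → ∀ α ∈ Icc (0:ℝ) 1, ∀ β ∈ Icc (0:ℝ) 1, ∀ a b : ℝ,
    0 ≤ w t α β a b
  le_bound : ∀ t, 0 ≤ t → ∀ α ∈ Icc (0:ℝ) 1, ∀ β ∈ Icc (0:ℝ) 1, ∀ a b : ℝ,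
    w t α β a b ≤ W

/-- `x` is a solution of the opinion dynamics with weight function `w`:
measurable in the agent, absolutely continuous in time on compact intervals,
with initial opinions in `[0,1]`, locally bounded, and for each agent satisfying
the ODE `(d/dt) x_t(α) = ∫_0^1 w(t,α,β,x_t(α),x_t(β))·(x_t(β) − x_t(α)) dβ`
for almost every `t ≥ 0`. -/
structure IsSolution (w : ℝ → ℝ → ℝ → ℝ → ℝ → ℝ) (x : ℝ → ℝ → ℝ) : Prop where
  meas : ∀ t, 0 ≤ t → Measurable (x t)
  absCont : ∀ α ∈ Icc (0:ℝ) 1, ∀ T, 0 ≤ T → AbsolutelyContinuousOn (fun t => x t α) 0 T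
  init_mem : ∀ α ∈ Icc (0:ℝ) 1, x 0 α ∈ Icc (0:ℝ) 1
  locBdd : ∀ T, 0 ≤ T → ∃ M : ℝ, ∀ α ∈ Icc (0:ℝ) 1, ∀ t ∈ Icc (0:ℝ) T, |x t α| ≤ M
  ode : ∀ α ∈ Icc (0:ℝ) 1, ∀ᵐ t ∂(volume.restrict (Ici (0:ℝ))),
    HasDerivAt (fun s => x s α) (interactionField w x t α) t

/-- The weight function is symmetric. -/
def SymmetricWeight (w : ℝ → ℝ → ℝ → ℝ → ℝ → ℝ) : Prop :=
  ∀ t α β a b, w t α β a b = w t β α b a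

/-- `w ∈ Γ(r,Δ)`: the weight is at least `Δ` whenever the two opinions are within `r`. -/
def InGamma (r Δ : ℝ) (w : ℝ → ℝ → ℝ → ℝ → ℝ → ℝ) : Prop :=
  ∀ t, 0 ≤ t → ∀ α ∈ Icc (0:ℝ) 1, ∀ β ∈ Icc (0:ℝ) 1, ∀ a b : ℝ,
    |a - b| ≤ r → Δ ≤ w t α β a b

/-- The opinion distribution `μ_t`: pushforward of Lebesgue measure on `[0,1]` by `x_t`. -/
noncomputable def opinionMeasure (x : ℝ → ℝ → ℝ) (t : ℝ) : Measure ℝ :=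
  (volume.restrict (Icc (0:ℝ) 1)).map (x t)

/-- The order of the opinions is preserved: if agent `β`'s opinion is strictly above
agent `α`'s at some time, it is strictly above at every time. -/
def OrderPreserved (x : ℝ → ℝ → ℝ) : Prop :=
  ∀ α ∈ Icc (0:ℝ) 1, ∀ β ∈ Icc (0:ℝ) 1, ∀ s, 0 ≤ s → ∀ t, 0 ≤ t →
    x t α < x t β → x s α < x s β

/-- The `ε`-`δ` definition over `Fin`-indexed families of intervals implies Mathlib's notion. -/
theorem AbsolutelyContinuousOn.absolutelyContinuousOnInterval {f : ℝ → ℝ} {a b : ℝ}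
    (hab : a ≤ b) (hf : AbsolutelyContinuousOn f a b) : AbsolutelyContinuousOnInterval f a b := by
  rw [absolutelyContinuousOnInterval_iff]
  intro ε hε
  obtain ⟨δ, hδ, h⟩ := hf ε hε
  refine ⟨δ, hδ, ?_⟩
  rintro ⟨n, I⟩ ⟨hI, hdisj⟩ hlen
  simp only [Finset.mem_range, uIcc_of_le hab, mem_Icc] at hI hlen ⊢
  have key := h n (fun i => min (I i).1 (I i).2) (fun i => max (I i).1 (I i).2)
    (fun i => ⟨le_min (hI i i.2).1.1 (hI i i.2).2.1, min_le_max,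
      max_le (hI i i.2).1.2 (hI i i.2).2.2⟩) ?_ ?_
  · rw [Finset.sum_range]
    refine lt_of_eq_of_lt (Finset.sum_congr rfl fun i _ => ?_) key
    rcases le_total (I i).1 (I i).2 with hle | hle
    · simp [hle, Real.dist_eq, abs_sub_comm]
    · simp [hle, Real.dist_eq]
  · intro i j hij
    have hd : Disjoint (uIoc (I i).1 (I i).2) (uIoc (I j).1 (I j).2) :=
      hdisj (by simp) (by simp) (fun hEq => hij (Fin.ext hEq))
    exact (hd.mono Ioo_subset_Ioc_self Ioo_subset_Ioc_self).inter_eq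
  · rw [Finset.sum_range] at hlen
    refine lt_of_eq_of_lt (Finset.sum_congr rfl fun i _ => ?_) hlen
    rw [Real.dist_eq, max_sub_min_eq_abs']

theorem AbsolutelyContinuousOnInterval.le_of_ae_hasDerivAt_nonneg {f f' : ℝ → ℝ} {a b : ℝ}
    (hab : a ≤ b) (hf : AbsolutelyContinuousOnInterval f a b)
    (hderiv : ∀ᵐ t ∂volume.restrict (Icc a b), HasDerivAt f (f' t) t ∧ 0 ≤ f' t) :
    f a ≤ f b := by
  rw [← sub_nonneg, ← hf.integral_deriv_eq_sub]
  refine intervalIntegral.integral_nonneg_of_ae_restrict hab ?_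
  filter_upwards [hderiv] with t ht
  simpa [ht.1.deriv] using ht.2

theorem AbsolutelyContinuousOnInterval.mul_exp_le_of_ae_hasDerivAt {f f' : ℝ → ℝ} {T W : ℝ}
    (hT : 0 ≤ T) (hf : AbsolutelyContinuousOnInterval f 0 T)
    (hderiv : ∀ᵐ t ∂volume.restrict (Icc 0 T), HasDerivAt f (f' t) t ∧ -W * f t ≤ f' t) :
    f 0 * Real.exp (-(W * T)) ≤ f T := by
  have hexp : AbsolutelyContinuousOnInterval (fun t => Real.exp (W * t)) 0 T := by
    have hcd : ContDiff ℝ 1 fun t : ℝ => Real.exp (W * t) := by fun_prop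
    exact hcd.contDiffOn.absolutelyContinuousOnInterval
  have hmono := (hf.fun_mul hexp).le_of_ae_hasDerivAt_nonneg hT
    (f' := fun t => f' t * Real.exp (W * t) + f t * (Real.exp (W * t) * W)) (by
      filter_upwards [hderiv] with t ht
      refine ⟨ht.1.mul ?_, ?_⟩
      · simpa using ((hasDerivAt_id t).const_mul W).exp
      · nlinarith [Real.exp_pos (W * t), ht.2])
  simp only [mul_zero, Real.exp_zero, mul_one] at hmono
  calc f 0 * Real.exp (-(W * T)) ≤ f T * Real.exp (W * T) * Real.exp (-(W * T)) := by gcongr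
    _ = f T := by rw [mul_assoc, ← Real.exp_add]; simp

/-- If all opinions at time `t` lie in `[L, U]`, each agent moves towards either end point at a
rate of at most `W` times its distance to that end point. -/
theorem IsSolution.interactionField_mem_Icc {W : ℝ} {w : ℝ → ℝ → ℝ → ℝ → ℝ → ℝ} {x : ℝ → ℝ → ℝ}
    (hw : IsWeight W w) (hx : IsSolution w x) {t L U : ℝ} (ht : 0 ≤ t)
    (hLU : ∀ β ∈ Icc (0:ℝ) 1, x t β ∈ Icc L U) {α : ℝ} (hα : α ∈ Icc (0:ℝ) 1) :
    interactionField w x t α ∈ Icc (W * (L - x t α)) (W * (U - x t α)) := by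
  have hbound : ∀ β ∈ Icc (0:ℝ) 1, w t α β (x t α) (x t β) * (x t β - x t α) ∈
      Icc (W * (L - x t α)) (W * (U - x t α)) := by
    intro β hβ
    have h0 := hw.nonneg t ht α hα β hβ (x t α) (x t β)
    have h1 := hw.le_bound t ht α hα β hβ (x t α) (x t β)
    obtain ⟨hβL, hβU⟩ := hLU β hβ
    obtain ⟨hαL, hαU⟩ := hLU α hα
    constructor <;> nlinarith
  have hxm := hx.meas t ht
  have hmeas : Measurable fun β => w t α β (x t α) (x t β) * (x t β - x t α) := by
    have hmap : Measurable fun β : ℝ => (t, α, β, x t α, x t β) := by fun_prop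
    exact (hw.measurable.comp hmap).mul (hxm.sub_const _)
  have hint : IntervalIntegrable (fun β => w t α β (x t α) (x t β) * (x t β - x t α))
      volume 0 1 := by
    rw [intervalIntegrable_iff_integrableOn_Icc_of_le zero_le_one]
    refine Measure.integrableOn_of_bounded (M := max |W * (L - x t α)| |W * (U - x t α)|)
      (by simp) hmeas.aestronglyMeasurable ?_
    filter_upwards [ae_restrict_mem measurableSet_Icc] with β hβ
    exact abs_le_max_abs_abs (hbound β hβ).1 (hbound β hβ).2
  constructor
  · simpa [interactionField] using intervalIntegral.integral_mono_on zero_le_one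
      intervalIntegrable_const hint fun β hβ => (hbound β hβ).1
  · simpa [interactionField] using intervalIntegral.integral_mono_on zero_le_one
      hint intervalIntegrable_const fun β hβ => (hbound β hβ).2

theorem IsSolution.absolutelyContinuousOnInterval {w : ℝ → ℝ → ℝ → ℝ → ℝ → ℝ} {x : ℝ → ℝ → ℝ}
    (hx : IsSolution w x) {α : ℝ} (hα : α ∈ Icc (0:ℝ) 1) {s t : ℝ} (hs : 0 ≤ s) (hst : s ≤ t) :
    AbsolutelyContinuousOnInterval (fun u => x u α) s t := by
  refine ((hx.absCont α hα t (hs.trans hst)).absolutelyContinuousOnInterval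
    (hs.trans hst)).mono ?_
  rw [uIcc_of_le hst, uIcc_of_le (hs.trans hst)]
  exact Icc_subset_Icc_left hs

theorem IsSolution.ae_hasDerivAt {w : ℝ → ℝ → ℝ → ℝ → ℝ → ℝ} {x : ℝ → ℝ → ℝ}
    (hx : IsSolution w x) {α : ℝ} (hα : α ∈ Icc (0:ℝ) 1) {s t : ℝ} (hs : 0 ≤ s) :
    ∀ᵐ u ∂volume.restrict (Icc s t), u ∈ Icc s t ∧
      HasDerivAt (fun u => x u α) (interactionField w x u α) u :=
  (ae_restrict_mem measurableSet_Icc).and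
    (ae_restrict_of_ae_restrict_of_subset (fun _ hu => hs.trans hu.1) (hx.ode α hα))

theorem absolutelyContinuousOnInterval_const_mul_id (c a b : ℝ) :
    AbsolutelyContinuousOnInterval (fun t => c * t) a b := by
  have hcd : ContDiff ℝ 1 fun t : ℝ => c * t := by fun_prop
  exact hcd.contDiffOn.absolutelyContinuousOnInterval

/-- An a priori bound on how far opinions leave `[0, 1]` up to time `T` improves by a fixed
factor. -/
theorem IsSolution.mem_Icc_contract {W : ℝ} (hW : 0 < W) {w : ℝ → ℝ → ℝ → ℝ → ℝ → ℝ}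
    {x : ℝ → ℝ → ℝ} (hw : IsWeight W w) (hx : IsSolution w x) {T C : ℝ} (hC : 0 ≤ C)
    (h : ∀ α ∈ Icc (0:ℝ) 1, ∀ t ∈ Icc 0 T, x t α ∈ Icc (-C) (1 + C)) :
    ∀ α ∈ Icc (0:ℝ) 1, ∀ t ∈ Icc 0 T, x t α ∈
      Icc (-(C * (1 - Real.exp (-(W * T))))) (1 + C * (1 - Real.exp (-(W * T)))) := by
  intro α hα t ht
  have hac := hx.absolutelyContinuousOnInterval hα le_rfl ht.1
  have hconst (c : ℝ) : AbsolutelyContinuousOnInterval (fun _ => c) 0 t :=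
    (contDiff_const (𝕜 := ℝ) (n := 1)).contDiffOn.absolutelyContinuousOnInterval
  have hode := hx.ae_hasDerivAt hα (t := t) le_rfl
  have hfield : ∀ u ∈ Icc 0 t, interactionField w x u α ∈
      Icc (W * (-C - x u α)) (W * (1 + C - x u α)) := fun u hu =>
    hx.interactionField_mem_Icc hw hu.1 (fun β hβ => h β hβ u ⟨hu.1, hu.2.trans ht.2⟩) hα
  have hlow := ((hconst C).fun_add hac).mul_exp_le_of_ae_hasDerivAt ht.1 (W := W)
    (f' := fun u => interactionField w x u α) (by
      filter_upwards [hode] with u hu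
      exact ⟨hu.2.const_add C, by linarith [(hfield u hu.1).1]⟩)
  have hupp := ((hconst (1 + C)).fun_sub hac).mul_exp_le_of_ae_hasDerivAt ht.1 (W := W)
    (f' := fun u => -interactionField w x u α) (by
      filter_upwards [hode] with u hu
      exact ⟨hu.2.const_sub (1 + C), by linarith [(hfield u hu.1).2]⟩)
  obtain ⟨h0, h1⟩ := hx.init_mem α hα
  have hexp : Real.exp (-(W * T)) ≤ Real.exp (-(W * t)) := by
    have := ht.2
    gcongr
  have hCexp : C * Real.exp (-(W * T)) ≤ C * Real.exp (-(W * t)) := by gcongr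
  have hlow' : C * Real.exp (-(W * t)) ≤ (C + x 0 α) * Real.exp (-(W * t)) := by
    gcongr; linarith
  have hupp' : C * Real.exp (-(W * t)) ≤ (1 + C - x 0 α) * Real.exp (-(W * t)) := by
    gcongr; linarith
  constructor <;> linarith

theorem IsSolution.mem_unitInterval {W : ℝ} (hW : 0 < W) {w : ℝ → ℝ → ℝ → ℝ → ℝ → ℝ}
    {x : ℝ → ℝ → ℝ} (hw : IsWeight W w) (hx : IsSolution w x) {α : ℝ} (hα : α ∈ Icc (0:ℝ) 1)
    {t : ℝ} (ht : 0 ≤ t) : x t α ∈ Icc (0:ℝ) 1 := by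
  obtain ⟨M, hM⟩ := hx.locBdd t ht
  have hM0 : 0 ≤ M := (abs_nonneg _).trans (hM α hα t ⟨ht, le_rfl⟩)
  set r := 1 - Real.exp (-(W * t)) with hr
  have hr0 : 0 ≤ r := by
    have : Real.exp (-(W * t)) ≤ 1 := Real.exp_le_one_iff.2 (by nlinarith)
    linarith
  have hr1 : r < 1 := by linarith [Real.exp_pos (-(W * t))]
  have hiter : ∀ n : ℕ, ∀ α ∈ Icc (0:ℝ) 1, ∀ s ∈ Icc 0 t,
      x s α ∈ Icc (-(M * r ^ n)) (1 + M * r ^ n) := by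
    intro n
    induction n with
    | zero =>
      intro α hα s hs
      have := abs_le.1 (hM α hα s hs)
      constructor <;> simp <;> linarith
    | succ n ih =>
      simpa only [pow_succ, mul_assoc] using hx.mem_Icc_contract hW hw (by positivity) ih
  have hlim : Tendsto (fun n : ℕ => M * r ^ n) atTop (𝓝 0) := by
    simpa using (tendsto_pow_atTop_nhds_zero_of_lt_one hr0 hr1).const_mul M
  constructor
  · exact le_of_tendsto (by simpa using hlim.neg)
      (Eventually.of_forall fun n => (hiter n α hα t ⟨ht, le_rfl⟩).1)
  · exact ge_of_tendsto (by simpa using hlim.const_add 1)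
      (Eventually.of_forall fun n => (hiter n α hα t ⟨ht, le_rfl⟩).2)

theorem IsSolution.abs_sub_le {W : ℝ} (hW : 0 < W) {w : ℝ → ℝ → ℝ → ℝ → ℝ → ℝ}
    {x : ℝ → ℝ → ℝ} (hw : IsWeight W w) (hx : IsSolution w x) {α : ℝ} (hα : α ∈ Icc (0:ℝ) 1)
    {s t : ℝ} (hs : 0 ≤ s) (hst : s ≤ t) : |x t α - x s α| ≤ W * (t - s) := by
  have hac := hx.absolutelyContinuousOnInterval hα hs hst
  have hlin := absolutelyContinuousOnInterval_const_mul_id W s t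
  have hlin' (u : ℝ) : HasDerivAt (fun v => W * v) W u := by
    simpa using (hasDerivAt_id u).const_mul W
  have hfield : ∀ u ∈ Icc s t, |interactionField w x u α| ≤ W := by
    intro u hu
    have hu0 := hs.trans hu.1
    obtain ⟨h0, h1⟩ := hx.mem_unitInterval hW hw hα hu0
    obtain ⟨hl, hu⟩ := hx.interactionField_mem_Icc hw hu0
      (fun β hβ => hx.mem_unitInterval hW hw hβ hu0) hα
    rw [abs_le]
    constructor <;> nlinarith
  have hode := hx.ae_hasDerivAt hα (t := t) hs
  have hupp := (hlin.fun_sub hac).le_of_ae_hasDerivAt_nonneg hst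
    (f' := fun u => W - interactionField w x u α) (by
      filter_upwards [hode] with u hu
      exact ⟨(hlin' u).sub hu.2, by linarith [(abs_le.1 (hfield u hu.1)).2]⟩)
  have hlow := (hlin.fun_add hac).le_of_ae_hasDerivAt_nonneg hst
    (f' := fun u => W + interactionField w x u α) (by
      filter_upwards [hode] with u hu
      exact ⟨(hlin' u).add hu.2, by linarith [(abs_le.1 (hfield u hu.1)).1]⟩)
  rw [abs_le]
  constructor <;> linarith

/-- Any solution of the opinion dynamics stays in `[0,1]` and is
`W`-Lipschitz in time. -/
theorem solution_stays_in_unit_interval_and_is_lipschitz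
    (W : ℝ) (hW : 0 < W) (w : ℝ → ℝ → ℝ → ℝ → ℝ → ℝ) (x : ℝ → ℝ → ℝ)
    (hw : IsWeight W w) (hx : IsSolution w x) :
    (∀ α ∈ Icc (0:ℝ) 1, ∀ t, 0 ≤ t → x t α ∈ Icc (0:ℝ) 1) ∧
    (∀ α ∈ Icc (0:ℝ) 1, ∀ s, 0 ≤ s → ∀ t, 0 ≤ t →
      |x t α - x s α| ≤ W * |t - s|) := by
  refine ⟨fun α hα t ht => hx.mem_unitInterval hW hw hα ht, fun α hα s hs t ht => ?_⟩
  rcases le_total s t with hst | hst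
  · rw [abs_of_nonneg (sub_nonneg.2 hst)]
    exact hx.abs_sub_le hW hw hα hs hst
  · rw [abs_sub_comm, abs_sub_comm t, abs_of_nonneg (sub_nonneg.2 hst)]
    exact hx.abs_sub_le hW hw hα ht hst
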